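/- Let 0 < β < α < 1 and assume f : ℝ → ℝ is non-decreasing. Let u : Ω̄ → ℝ be bounded, continuous, and a viscosity subsolution of L[u] = f(u) on Ω. Then for every open set ω compactly contained in Ω and all x, x' ∈ ω, |u(x) − u(x')| ≤ C|x − x'|^β, where C = max{ 2‖u‖_∞ / dist(ω, ∂Ω)^β , diam(Ω)^{α−β} · max(−f(−‖u‖_∞), 0) / (1 − Ψ(r⋆)) } and Ψ(r⋆) = (r⋆^β − 1)/(r⋆ − 1)^α < 1. -/

import Mathlib

open Set Metric

/-- The fractional sup-operator `L⁺[u](x)`. -/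
noncomputable def Lplus {n : ℕ} (Ω : Set (EuclideanSpace ℝ (Fin n))) (α : ℝ)
    (u : EuclideanSpace ℝ (Fin n) → ℝ) (x : EuclideanSpace ℝ (Fin n)) : ℝ :=
  sSup ((fun y => (u y - u x) / ‖y - x‖ ^ α) '' (closure Ω \ {x}))

/-- The fractional inf-operator `L⁻[u](x)`. -/
noncomputable def Lminus {n : ℕ} (Ω : Set (EuclideanSpace ℝ (Fin n))) (α : ℝ)
    (u : EuclideanSpace ℝ (Fin n) → ℝ) (x : EuclideanSpace ℝ (Fin n)) : ℝ :=
  sInf ((fun y => (u y - u x) / ‖y - x‖ ^ α) '' (closure Ω \ {x}))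

/-- The fractional infinity Laplacian `L[u](x) = L⁺[u](x) + L⁻[u](x)`. -/
noncomputable def Lop {n : ℕ} (Ω : Set (EuclideanSpace ℝ (Fin n))) (α : ℝ)
    (u : EuclideanSpace ℝ (Fin n) → ℝ) (x : EuclideanSpace ℝ (Fin n)) : ℝ :=
  Lplus Ω α u x + Lminus Ω α u x

/-- `u` is a viscosity subsolution of `L[u] = f(u)` on `U ⊆ Ω`. -/
def IsViscositySubsolution {n : ℕ} (Ω U : Set (EuclideanSpace ℝ (Fin n))) (α : ℝ)
    (f : ℝ → ℝ) (u : EuclideanSpace ℝ (Fin n) → ℝ) : Prop :=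
  UpperSemicontinuousOn u (closure Ω) ∧
  ∀ φ : EuclideanSpace ℝ (Fin n) → ℝ,
    ContDiffOn ℝ 1 φ U → ContinuousOn φ (closure Ω) →
    (∀ x ∈ closure Ω, u x ≤ φ x) →
    ∀ x₀ ∈ U, u x₀ = φ x₀ → -Lop Ω α φ x₀ + f (φ x₀) ≤ 0

/-- `u` is a viscosity supersolution of `L[u] = f(u)` on `U ⊆ Ω`. -/
def IsViscositySupersolution {n : ℕ} (Ω U : Set (EuclideanSpace ℝ (Fin n))) (α : ℝ)
    (f : ℝ → ℝ) (u : EuclideanSpace ℝ (Fin n) → ℝ) : Prop :=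
  LowerSemicontinuousOn u (closure Ω) ∧
  ∀ φ : EuclideanSpace ℝ (Fin n) → ℝ,
    ContDiffOn ℝ 1 φ U → ContinuousOn φ (closure Ω) →
    (∀ x ∈ closure Ω, φ x ≤ u x) →
    ∀ x₀ ∈ U, u x₀ = φ x₀ → 0 ≤ -Lop Ω α φ x₀ + f (φ x₀)

/-- `u` is a strict viscosity supersolution of `L[u] = f(u)` on `U ⊆ Ω`. -/
def IsStrictViscositySupersolution {n : ℕ} (Ω U : Set (EuclideanSpace ℝ (Fin n))) (α : ℝ)
    (f : ℝ → ℝ) (u : EuclideanSpace ℝ (Fin n) → ℝ) : Prop :=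
  LowerSemicontinuousOn u (closure Ω) ∧
  ∀ φ : EuclideanSpace ℝ (Fin n) → ℝ,
    ContDiffOn ℝ 1 φ U → ContinuousOn φ (closure Ω) →
    (∀ x ∈ closure Ω, φ x ≤ u x) →
    ∀ x₀ ∈ U, u x₀ = φ x₀ → 0 < -Lop Ω α φ x₀ + f (φ x₀)

/-! ### One-variable inequalities for the quotient `(r ^ β - 1) / (r - 1) ^ α` -/

theorem rpow_sub_one_div_lt_one {α β r : ℝ} (hβ0 : 0 < β) (hβα : β < α) (hα1 : α < 1)
    (hr : 1 < r) : (r ^ β - 1) / (r - 1) ^ α < 1 := by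
  have hr1 : 0 < r - 1 := by linarith
  rw [div_lt_one (Real.rpow_pos_of_pos hr1 α)]
  rcases le_total (r - 1) 1 with h | h
  · have h1 : r ^ β < r ^ (1 : ℝ) := Real.rpow_lt_rpow_of_exponent_lt hr (by linarith)
    have h2 : (r - 1) ^ (1 : ℝ) ≤ (r - 1) ^ α :=
      Real.rpow_le_rpow_of_exponent_ge hr1 h hα1.le
    rw [Real.rpow_one] at h1 h2
    linarith
  · rcases h.eq_or_lt with h | h
    · have h2 : r = 2 := by linarith
      subst h2
      have h1 : (2 : ℝ) ^ β < 2 ^ (1 : ℝ) :=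
        Real.rpow_lt_rpow_of_exponent_lt (by norm_num) (by linarith)
      rw [Real.rpow_one] at h1
      norm_num
      linarith
    · have h1 : (r - 1) ^ β < (r - 1) ^ α := Real.rpow_lt_rpow_of_exponent_lt h hβα
      have h2 : (r - 1 + 1) ^ β ≤ (r - 1) ^ β + 1 ^ β :=
        Real.rpow_add_le_add_rpow hr1.le zero_le_one hβ0.le (by linarith)
      rw [Real.one_rpow, sub_add_cancel] at h2
      linarith

theorem rpow_sub_one_div_nonneg {α β r : ℝ} (hβ0 : 0 < β) (hr : 1 < r) :
    0 ≤ (r ^ β - 1) / (r - 1) ^ α :=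
  div_nonneg (sub_nonneg.2 (Real.one_le_rpow hr.le hβ0.le))
    (Real.rpow_nonneg (sub_nonneg.2 hr.le) _)

theorem hasDerivAt_rpow_sub_one_div (α β : ℝ) {r : ℝ} (hr : 1 < r) :
    HasDerivAt (fun r : ℝ => (r ^ β - 1) / (r - 1) ^ α)
      (-((α - β) * r ^ β + β * r ^ (β - 1) - α) * (r - 1) ^ (α - 1) / ((r - 1) ^ α) ^ 2) r := by
  have hr0 : 0 < r := by linarith
  have hr1 : 0 < r - 1 := by linarith
  have h1 : HasDerivAt (fun r : ℝ => r ^ β - 1) (β * r ^ (β - 1)) r :=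
    (Real.hasDerivAt_rpow_const (Or.inl hr0.ne')).sub_const 1
  have h2 : HasDerivAt (fun r : ℝ => (r - 1) ^ α) (1 * α * (r - 1) ^ (α - 1)) r :=
    ((hasDerivAt_id r).sub_const 1).rpow_const (Or.inl hr1.ne')
  refine (h1.div h2 (Real.rpow_pos_of_pos hr1 α).ne').congr_deriv ?_
  congr 1
  have h3 : (r - 1) ^ α = (r - 1) ^ (α - 1) * (r - 1) := by
    rw [Real.rpow_sub_one hr1.ne']
    field_simp
  have h4 : r ^ β = r ^ (β - 1) * r := by
    rw [Real.rpow_sub_one hr0.ne']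
    field_simp
  rw [h3, h4]
  ring

theorem critical_eq_rpow_mul {α β r : ℝ} (hr : 0 < r) :
    (α - β) * r ^ β + β * r ^ (β - 1) - α =
      r ^ (β - 1) * ((α - β) * r + β - α * r ^ (1 - β)) := by
  have h1 : r ^ (β - 1) * r ^ (1 - β) = 1 := by
    rw [← Real.rpow_add hr]
    simp
  have h2 : r ^ β = r ^ (β - 1) * r := by
    rw [Real.rpow_sub_one hr.ne']
    field_simp
  rw [h2]
  linear_combination α * h1

theorem convexOn_critical {α β : ℝ} (hβ0 : 0 < β) (hβα : β < α) (hα1 : α < 1) :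
    ConvexOn ℝ (Ici 0) (fun r : ℝ => (α - β) * r + β - α * r ^ (1 - β)) := by
  have h1 : ConcaveOn ℝ (Ici 0) (fun r : ℝ => α * r ^ (1 - β)) :=
    (Real.concaveOn_rpow (by linarith) (by linarith)).smul (c := α) (by linarith)
  have h2 : ConvexOn ℝ (Ici 0) (fun r : ℝ => (α - β) * r + β) :=
    ((convexOn_id (convex_Ici 0)).smul (c := α - β) (by linarith)).add_const β
  exact h2.sub h1

/-- `(r ^ β - 1) / (r - 1) ^ α` is maximal over `r > 1` at its critical point. -/
theorem rpow_sub_one_div_le {α β rs r : ℝ} (hβ0 : 0 < β) (hβα : β < α) (hα1 : α < 1)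
    (hrs : 1 < rs) (heq : (α - β) * rs ^ β + β * rs ^ (β - 1) - α = 0) (hr : 1 < r) :
    (r ^ β - 1) / (r - 1) ^ α ≤ (rs ^ β - 1) / (rs - 1) ^ α := by
  set h : ℝ → ℝ := fun r => (α - β) * r + β - α * r ^ (1 - β) with hh
  have hcv : ConvexOn ℝ (Ici 0) h := convexOn_critical hβ0 hβα hα1
  have h1 : h 1 = 0 := by simp [hh]
  have hs : h rs = 0 := by
    rw [critical_eq_rpow_mul (by linarith)] at heq
    exact (mul_eq_zero.1 heq).resolve_left (Real.rpow_pos_of_pos (by linarith) _).ne'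
  have hcont : ∀ s ⊆ Ioi (1 : ℝ), ContinuousOn (fun r : ℝ => (r ^ β - 1) / (r - 1) ^ α) s :=
    fun s hs x hx => (hasDerivAt_rpow_sub_one_div α β (hs hx)).continuousAt.continuousWithinAt
  rcases le_total r rs with hle | hle
  · have hmono : MonotoneOn (fun r : ℝ => (r ^ β - 1) / (r - 1) ^ α) (Icc r rs) := by
      refine monotoneOn_of_deriv_nonneg (convex_Icc _ _)
        (hcont _ fun x hx => hr.trans_le hx.1) ?_ ?_
      all_goals
        intro x hx
        rw [interior_Icc] at hx
        have hx1 : 1 < x := hr.trans hx.1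
      · exact (hasDerivAt_rpow_sub_one_div α β hx1).differentiableAt.differentiableWithinAt
      · rw [(hasDerivAt_rpow_sub_one_div α β hx1).deriv, critical_eq_rpow_mul (by linarith)]
        have hneg : h x ≤ 0 := by
          have := hcv.le_on_segment (x := 1) (y := rs) (z := x) (by simp)
            (by simp; linarith) (by
              rw [segment_eq_Icc hrs.le]
              exact ⟨hx1.le, hx.2.le⟩)
          simpa [h1, hs] using this
        have hp : 0 ≤ x ^ (β - 1) := Real.rpow_nonneg (by linarith) _
        have hq : 0 ≤ (x - 1) ^ (α - 1) := Real.rpow_nonneg (by linarith) _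
        exact div_nonneg (mul_nonneg (neg_nonneg.2 (mul_nonpos_of_nonneg_of_nonpos hp hneg)) hq)
          (sq_nonneg _)
    exact hmono ⟨le_rfl, hle⟩ ⟨hle, le_rfl⟩ hle
  · have hanti : AntitoneOn (fun r : ℝ => (r ^ β - 1) / (r - 1) ^ α) (Icc rs r) := by
      refine antitoneOn_of_deriv_nonpos (convex_Icc _ _)
        (hcont _ fun x hx => hrs.trans_le hx.1) ?_ ?_
      all_goals
        intro x hx
        rw [interior_Icc] at hx
        have hx1 : 1 < x := hrs.trans hx.1
      · exact (hasDerivAt_rpow_sub_one_div α β hx1).differentiableAt.differentiableWithinAt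
      · rw [(hasDerivAt_rpow_sub_one_div α β hx1).deriv, critical_eq_rpow_mul (by linarith)]
        have hpos : 0 ≤ h x := by
          have := hcv.slope_mono_adjacent (x := 1) (y := rs) (z := x) (by simp)
            (by simp; linarith) hrs hx.1
          rw [h1, hs, sub_zero, zero_div, sub_zero] at this
          have hd : 0 < x - rs := sub_pos.2 hx.1
          rwa [le_div_iff₀ hd, zero_mul] at this
        have hp : 0 ≤ x ^ (β - 1) := Real.rpow_nonneg (by linarith) _
        have hq : 0 ≤ (x - 1) ^ (α - 1) := Real.rpow_nonneg (by linarith) _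
        exact div_nonpos_of_nonpos_of_nonneg
          (mul_nonpos_of_nonpos_of_nonneg (neg_nonpos.2 (mul_nonneg hp hpos)) hq) (sq_nonneg _)
    exact hanti ⟨le_rfl, hle⟩ ⟨hle, le_rfl⟩ hle

/-- Scaled form of a uniform bound on `(r ^ β - 1) / (r - 1) ^ α`. -/
theorem rpow_sub_rpow_le {α β K a b t : ℝ} (hβ0 : 0 < β) (hα0 : 0 < α) (hK : 0 ≤ K)
    (hbound : ∀ r : ℝ, 1 < r → (r ^ β - 1) / (r - 1) ^ α ≤ K)
    (ha : 0 < a) (hb : 0 < b) (ht : b - a ≤ t) (ht0 : 0 ≤ t) :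
    b ^ β - a ^ β ≤ K * a ^ (β - α) * t ^ α := by
  have haα : 0 < a ^ (β - α) := Real.rpow_pos_of_pos ha _
  rcases le_or_gt b a with hba | hab
  · have h1 : b ^ β ≤ a ^ β := Real.rpow_le_rpow hb.le hba hβ0.le
    have h2 : 0 ≤ K * a ^ (β - α) * t ^ α := by positivity
    linarith
  · have hr : 1 < b / a := (one_lt_div ha).2 hab
    have h1 := hbound _ hr
    have hba : 0 < b - a := sub_pos.2 hab
    have h2 : b / a - 1 = (b - a) / a := by field_simp
    rw [h2, Real.div_rpow hb.le ha.le, Real.div_rpow hba.le ha.le,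
      div_le_iff₀ (by positivity)] at h1
    have haβ : 0 < a ^ β := Real.rpow_pos_of_pos ha _
    have h3 : b ^ β - a ^ β = (b ^ β / a ^ β - 1) * a ^ β := by field_simp
    have h4 : K * a ^ (β - α) * (b - a) ^ α = K * ((b - a) ^ α / a ^ α) * a ^ β := by
      rw [Real.rpow_sub ha]
      ring
    have h5 : (b - a) ^ α ≤ t ^ α := Real.rpow_le_rpow hba.le ht hα0.le
    calc b ^ β - a ^ β ≤ K * ((b - a) ^ α / a ^ α) * a ^ β := by
          rw [h3]
          gcongr
      _ = K * a ^ (β - α) * (b - a) ^ α := h4.symm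
      _ ≤ K * a ^ (β - α) * t ^ α := by gcongr

/-! ### The regularized distance -/

section RegDist

variable {E : Type*} [NormedAddCommGroup E]

/-- A smooth regularization of the distance to `z`. -/
noncomputable def regDist (s : ℝ) (z x : E) : ℝ := √(‖x - z‖ ^ 2 + s ^ 2)

theorem regDist_pos {s : ℝ} (hs : 0 < s) (z x : E) : 0 < regDist s z x :=
  Real.sqrt_pos.2 (by positivity)

theorem regDist_self {s : ℝ} (hs : 0 ≤ s) (z : E) : regDist s z z = s := by
  simp [regDist, Real.sqrt_sq hs]

theorem le_regDist (s : ℝ) (z x : E) : s ≤ regDist s z x :=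
  Real.le_sqrt_of_sq_le (by nlinarith [sq_nonneg ‖x - z‖])

theorem norm_sub_le_regDist (s : ℝ) (z x : E) : ‖x - z‖ ≤ regDist s z x :=
  Real.le_sqrt_of_sq_le (by nlinarith [sq_nonneg s])

theorem regDist_sub_le {s : ℝ} (hs : 0 < s) (z x y : E) :
    regDist s z y - regDist s z x ≤ ‖y - x‖ := by
  have h1 : ‖y - z‖ ≤ ‖y - x‖ + ‖x - z‖ := norm_sub_le_norm_sub_add_norm_sub y x z
  have h2 := norm_sub_le_regDist s z x
  have h3 : regDist s z x ^ 2 = ‖x - z‖ ^ 2 + s ^ 2 := Real.sq_sqrt (by positivity)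
  have h4 : regDist s z y ≤ ‖y - x‖ + regDist s z x := by
    refine Real.sqrt_le_iff.2 ⟨by linarith [norm_nonneg (y - x), regDist_pos hs z x], ?_⟩
    nlinarith [norm_nonneg (y - x), norm_nonneg (x - z), norm_nonneg (y - z)]
  linarith

theorem contDiff_regDist_rpow [InnerProductSpace ℝ E] {s : ℝ} (hs : 0 < s) (z : E) (β : ℝ) :
    ContDiff ℝ 1 (fun x => regDist s z x ^ β) := by
  have h1 : ContDiff ℝ 1 (fun x : E => regDist s z x) := by
    refine ContDiff.sqrt ?_ fun x => by positivity
    exact ((contDiff_id.sub contDiff_const).norm_sq ℝ).add contDiff_const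
  exact h1.rpow_const_of_ne fun x => (regDist_pos hs z x).ne'

theorem continuous_regDist_left (z x : E) : Continuous fun s : ℝ => regDist s z x := by
  unfold regDist
  fun_prop

theorem regDist_zero (z x : E) : regDist 0 z x = ‖x - z‖ := by
  simp [regDist]

end RegDist

/-! ### The operator on the barrier -/

section Barrier

variable {n : ℕ} {Ω : Set (EuclideanSpace ℝ (Fin n))} {α β K C s k : ℝ}
  {z x : EuclideanSpace ℝ (Fin n)}

theorem Lplus_barrier_le (hβ0 : 0 < β) (hβα : β < α) (hK : 0 ≤ K)
    (hbound : ∀ r : ℝ, 1 < r → (r ^ β - 1) / (r - 1) ^ α ≤ K)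
    (hC : 0 ≤ C) (hs : 0 < s) (hz : z ∈ closure Ω) (hxz : x ≠ z) :
    Lplus Ω α (fun y => C * regDist s z y ^ β + k) x ≤ C * K * ‖x - z‖ ^ (β - α) := by
  have hρ : 0 < ‖x - z‖ := norm_pos_iff.2 (sub_ne_zero.2 hxz)
  refine csSup_le (Set.Nonempty.image _ ⟨z, hz, fun h => hxz h.symm⟩) ?_
  rintro _ ⟨y, ⟨-, hyx⟩, rfl⟩
  have ht : 0 < ‖y - x‖ := norm_pos_iff.2 (sub_ne_zero.2 hyx)
  have h1 := rpow_sub_rpow_le hβ0 (hβ0.trans hβα) hK hbound (regDist_pos hs z x)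
    (regDist_pos hs z y) (regDist_sub_le hs z x y) ht.le
  have h2 : regDist s z x ^ (β - α) ≤ ‖x - z‖ ^ (β - α) :=
    Real.rpow_le_rpow_of_nonpos hρ (norm_sub_le_regDist s z x) (by linarith)
  have htα : 0 < ‖y - x‖ ^ α := Real.rpow_pos_of_pos ht _
  simp only
  rw [div_le_iff₀ htα]
  calc C * regDist s z y ^ β + k - (C * regDist s z x ^ β + k)
      = C * (regDist s z y ^ β - regDist s z x ^ β) := by ring
    _ ≤ C * (K * regDist s z x ^ (β - α) * ‖y - x‖ ^ α) := by gcongr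
    _ ≤ C * (K * ‖x - z‖ ^ (β - α) * ‖y - x‖ ^ α) := by gcongr
    _ = C * K * ‖x - z‖ ^ (β - α) * ‖y - x‖ ^ α := by ring

theorem Lminus_barrier_le (hβ0 : 0 < β) (hβα : β < α) (hK : 0 ≤ K)
    (hbound : ∀ r : ℝ, 1 < r → (r ^ β - 1) / (r - 1) ^ α ≤ K)
    (hC : 0 ≤ C) (hs : 0 < s) (hz : z ∈ closure Ω) (hxz : x ≠ z) :
    Lminus Ω α (fun y => C * regDist s z y ^ β + k) x ≤
      C * (s ^ β - ‖x - z‖ ^ β) / ‖x - z‖ ^ α := by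
  have hbdd : BddBelow ((fun y => ((C * regDist s z y ^ β + k) - (C * regDist s z x ^ β + k)) /
      ‖y - x‖ ^ α) '' (closure Ω \ {x})) := by
    refine ⟨-(C * K * s ^ (β - α)), ?_⟩
    rintro _ ⟨y, ⟨-, hyx⟩, rfl⟩
    have ht : 0 < ‖y - x‖ := norm_pos_iff.2 (sub_ne_zero.2 hyx)
    have htα : 0 < ‖y - x‖ ^ α := Real.rpow_pos_of_pos ht _
    have h1 := rpow_sub_rpow_le hβ0 (hβ0.trans hβα) hK hbound (regDist_pos hs z y)
      (regDist_pos hs z x) ((regDist_sub_le hs z y x).trans_eq (norm_sub_rev x y)) ht.le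
    have h2 : regDist s z y ^ (β - α) ≤ s ^ (β - α) :=
      Real.rpow_le_rpow_of_nonpos hs (le_regDist s z y) (by linarith)
    simp only
    rw [le_div_iff₀ htα]
    have h3 : C * (regDist s z x ^ β - regDist s z y ^ β) ≤
        C * (K * s ^ (β - α) * ‖y - x‖ ^ α) := by
      refine mul_le_mul_of_nonneg_left (h1.trans ?_) hC
      gcongr
    linarith
  refine (csInf_le hbdd ⟨z, ⟨hz, fun h => hxz h.symm⟩, rfl⟩).trans ?_
  simp only [regDist_self hs.le]
  rw [norm_sub_rev z x]
  have h1 : ‖x - z‖ ^ β ≤ regDist s z x ^ β :=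
    Real.rpow_le_rpow (norm_nonneg _) (norm_sub_le_regDist s z x) hβ0.le
  gcongr ?_ / _
  nlinarith

end Barrier

/-! ### Geometry of the domain -/

theorem sInf_infDist_frontier_pos {n : ℕ} (hn : 1 ≤ n) {Ω ω : Set (EuclideanSpace ℝ (Fin n))}
    (hΩo : IsOpen Ω) (hΩne : Ω.Nonempty) (hΩb : Bornology.IsBounded Ω) (hωne : ω.Nonempty)
    (hωΩ : closure ω ⊆ Ω) : 0 < sInf ((fun a => infDist a (frontier Ω)) '' ω) := by
  have : Nonempty (Fin n) := ⟨⟨0, hn⟩⟩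
  have hfr : (frontier Ω).Nonempty := by
    refine nonempty_frontier_iff.2 ⟨hΩne, fun h => ?_⟩
    rw [h] at hΩb
    exact NormedSpace.unbounded_univ ℝ (EuclideanSpace ℝ (Fin n)) hΩb
  have hcomp : IsCompact (closure ω) :=
    (hΩb.subset (subset_closure.trans hωΩ)).isCompact_closure
  obtain ⟨a, ha, hmin⟩ := hcomp.exists_isMinOn hωne.closure
    (continuous_infDist_pt (frontier Ω)).continuousOn
  have hapos : 0 < infDist a (frontier Ω) := by
    refine (isClosed_frontier.notMem_iff_infDist_pos hfr).1 fun h => ?_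
    rw [hΩo.frontier_eq] at h
    exact h.2 (hωΩ ha)
  refine hapos.trans_le (le_csInf (hωne.image _) ?_)
  rintro _ ⟨b, hb, rfl⟩
  exact hmin (subset_closure hb)

theorem mem_of_norm_sub_lt_infDist_frontier {n : ℕ} {Ω : Set (EuclideanSpace ℝ (Fin n))}
    {x z : EuclideanSpace ℝ (Fin n)} (hΩo : IsOpen Ω) (hx : x ∈ closure Ω)
    (hxz : ‖x - z‖ < infDist z (frontier Ω)) : x ∈ Ω := by
  by_contra hxΩ
  have h1 : x ∈ frontier Ω := by
    rw [hΩo.frontier_eq]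
    exact ⟨hx, hxΩ⟩
  have h2 := infDist_le_dist_of_mem (x := z) h1
  rw [dist_comm, dist_eq_norm] at h2
  linarith

/-! ### The one-sided Hölder estimate -/

theorem IsViscositySubsolution.sub_le {n : ℕ} {Ω : Set (EuclideanSpace ℝ (Fin n))}
    {α β K C d M : ℝ} {f : ℝ → ℝ} {u : EuclideanSpace ℝ (Fin n) → ℝ}
    {z xb : EuclideanSpace ℝ (Fin n)}
    (hu : IsViscositySubsolution Ω Ω α f u) (hf : Monotone f)
    (hΩo : IsOpen Ω) (hΩb : Bornology.IsBounded Ω) (huc : ContinuousOn u (closure Ω))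
    (hM : ∀ x ∈ closure Ω, |u x| ≤ M)
    (hβ0 : 0 < β) (hβα : β < α) (hK : 0 ≤ K) (hK1 : K < 1)
    (hbound : ∀ r : ℝ, 1 < r → (r ^ β - 1) / (r - 1) ^ α ≤ K)
    (hz : z ∈ Ω) (hxb : xb ∈ closure Ω) (hd : 0 < d) (hdz : d ≤ infDist z (frontier Ω))
    (hC1 : 2 * M / d ^ β < C)
    (hC2 : diam Ω ^ (α - β) * max (-f (-M)) 0 / (1 - K) < C) :
    u xb - u z ≤ C * ‖xb - z‖ ^ β := by
  by_contra! hcon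
  have hzc : z ∈ closure Ω := subset_closure hz
  have hC0 : 0 < C := by
    refine lt_of_le_of_lt (div_nonneg (mul_nonneg (Real.rpow_nonneg diam_nonneg _)
      (le_max_right _ _)) (by linarith)) hC2
  set δ := (u xb - u z - C * ‖xb - z‖ ^ β) / 2 with hδ
  have hδ0 : 0 < δ := by rw [hδ]; linarith
  obtain ⟨η, hη0, hη⟩ := Metric.continuousWithinAt_iff.1 (huc z hzc) δ hδ0
  rw [div_lt_iff₀ (by linarith)] at hC2
  obtain ⟨s, ⟨hs1, hs2⟩, hs0⟩ : ∃ s : ℝ, (C * regDist s z xb ^ β < C * ‖xb - z‖ ^ β + δ ∧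
      C * (s ^ β * η ^ (-β)) < C * (1 - K) - diam Ω ^ (α - β) * max (-f (-M)) 0) ∧ 0 < s := by
    have c1 : Continuous fun s : ℝ => C * regDist s z xb ^ β :=
      continuous_const.mul ((continuous_regDist_left z xb).rpow_const fun _ => Or.inr hβ0.le)
    have c2 : Continuous fun s : ℝ => C * (s ^ β * η ^ (-β)) :=
      continuous_const.mul ((continuous_id.rpow_const fun _ => Or.inr hβ0.le).mul continuous_const)
    have e1 := (c1.tendsto 0).eventually_lt_const
      (u := C * ‖xb - z‖ ^ β + δ) (by rw [regDist_zero]; linarith)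
    have e2 := (c2.tendsto 0).eventually_lt_const
      (u := C * (1 - K) - diam Ω ^ (α - β) * max (-f (-M)) 0)
      (by rw [Real.zero_rpow hβ0.ne']; linarith)
    have e3 := (e1.and e2).filter_mono (nhdsWithin_le_nhds (s := Ioi 0))
    exact (e3.and self_mem_nhdsWithin).exists
  have hcd : ContDiff ℝ 1 fun x => C * regDist s z x ^ β :=
    contDiff_const.mul (contDiff_regDist_rpow hs0 z β)
  obtain ⟨x, hxc, hmax⟩ := hΩb.isCompact_closure.exists_isMaxOn ⟨z, hzc⟩
    (huc.sub hcd.continuous.continuousOn)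
  have hgap : δ < u x - u z - C * regDist s z x ^ β := by
    have h := hmax hxb
    simp only [mem_ofPred_eq, Pi.sub_apply] at h
    linarith
  have hreg : C * ‖x - z‖ ^ β ≤ C * regDist s z x ^ β :=
    mul_le_mul_of_nonneg_left
      (Real.rpow_le_rpow (norm_nonneg _) (norm_sub_le_regDist s z x) hβ0.le) hC0.le
  have hρβ : 0 ≤ C * ‖x - z‖ ^ β := by positivity
  have hηρ : η ≤ ‖x - z‖ := by
    by_contra! hlt
    have h := hη hxc (by rwa [dist_eq_norm])
    rw [Real.dist_eq] at h
    linarith [le_abs_self (u x - u z)]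
  have hρ : 0 < ‖x - z‖ := hη0.trans_le hηρ
  have hxz : x ≠ z := fun h => by simp [h] at hρ
  have hxd : ‖x - z‖ < d := by
    by_contra! hle
    have h1 : d ^ β ≤ ‖x - z‖ ^ β := Real.rpow_le_rpow hd.le hle hβ0.le
    rw [div_lt_iff₀ (Real.rpow_pos_of_pos hd _)] at hC1
    have h2 := mul_le_mul_of_nonneg_left h1 hC0.le
    have h3 := abs_le.1 (hM x hxc)
    have h4 := abs_le.1 (hM z hzc)
    linarith
  have hxΩ : x ∈ Ω := mem_of_norm_sub_lt_infDist_frontier hΩo hxc (hxd.trans_le hdz)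
  set k := u x - C * regDist s z x ^ β with hk
  have hsub := hu.2 (fun y => C * regDist s z y ^ β + k) (hcd.add contDiff_const).contDiffOn
    (hcd.add contDiff_const).continuous.continuousOn
    (fun y hy => by
      have h := hmax hy
      simp only [mem_ofPred_eq, Pi.sub_apply] at h
      linarith) x hxΩ (by rw [hk]; ring)
  have hfx : f (-M) ≤ f (C * regDist s z x ^ β + k) := by
    refine hf ?_
    have h3 := abs_le.1 (hM x hxc)
    rw [hk]
    linarith
  have hL1 := Lplus_barrier_le (k := k) hβ0 hβα hK hbound hC0.le hs0 hzc hxz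
  have hL2 := Lminus_barrier_le (k := k) hβ0 hβα hK hbound hC0.le hs0 hzc hxz
  unfold Lop at hsub
  have hkey : f (-M) ≤ C * K * ‖x - z‖ ^ (β - α) +
      C * (s ^ β - ‖x - z‖ ^ β) / ‖x - z‖ ^ α := by linarith
  have hdiam : ‖x - z‖ ≤ diam Ω := by
    rw [← dist_eq_norm]
    exact dist_le_diam_of_mem hΩb hxΩ hz
  have hpow : 0 < ‖x - z‖ ^ (α - β) := Real.rpow_pos_of_pos hρ _
  have hmul := mul_le_mul_of_nonneg_right hkey hpow.le
  have hexp : (C * K * ‖x - z‖ ^ (β - α) + C * (s ^ β - ‖x - z‖ ^ β) / ‖x - z‖ ^ α) *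
      ‖x - z‖ ^ (α - β) = C * K + C * (s ^ β * ‖x - z‖ ^ (-β)) - C := by
    rw [Real.rpow_sub hρ, Real.rpow_sub hρ, Real.rpow_neg hρ.le]
    have h1 : ‖x - z‖ ^ α ≠ 0 := (Real.rpow_pos_of_pos hρ _).ne'
    have h2 : ‖x - z‖ ^ β ≠ 0 := (Real.rpow_pos_of_pos hρ _).ne'
    field_simp
    ring
  have h5 : ‖x - z‖ ^ (-β) ≤ η ^ (-β) := Real.rpow_le_rpow_of_nonpos hη0 hηρ (by linarith)
  have h6 : C * (s ^ β * ‖x - z‖ ^ (-β)) ≤ C * (s ^ β * η ^ (-β)) := by gcongr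
  have h7 : -f (-M) * ‖x - z‖ ^ (α - β) ≤ diam Ω ^ (α - β) * max (-f (-M)) 0 := by
    rw [mul_comm]
    calc ‖x - z‖ ^ (α - β) * -f (-M) ≤ ‖x - z‖ ^ (α - β) * max (-f (-M)) 0 := by
          gcongr
          exact le_max_left _ _
      _ ≤ diam Ω ^ (α - β) * max (-f (-M)) 0 := by
          have h8 : ‖x - z‖ ^ (α - β) ≤ diam Ω ^ (α - β) :=
            Real.rpow_le_rpow hρ.le hdiam (by linarith)
          exact mul_le_mul_of_nonneg_right h8 (le_max_right _ _)
  rw [hexp] at hmul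
  linarith

/-- Interior β-Hölder estimate for bounded continuous viscosity subsolutions of
`L[u] = f(u)` with the explicit constant
`C = max (2‖u‖_∞ / dist(ω,∂Ω)^β) (diam(Ω)^(α−β) · (f(−‖u‖_∞))₋ / (1 − Ψ(rs)))`,
where `Ψ(rs) = (rs^β − 1)/(rs − 1)^α < 1`. -/
theorem stmt_14 (n : ℕ) (hn : 1 ≤ n) (Ω : Set (EuclideanSpace ℝ (Fin n)))
    (hΩo : IsOpen Ω) (hΩne : Ω.Nonempty) (hΩb : Bornology.IsBounded Ω)
    (α β : ℝ) (hβ0 : 0 < β) (hβα : β < α) (hα1 : α < 1)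
    (rs : ℝ) (hrs : 1 < rs)
    (heq : (α - β) * rs ^ β + β * rs ^ (β - 1) - α = 0)
    (f : ℝ → ℝ) (hf : Monotone f)
    (u : EuclideanSpace ℝ (Fin n) → ℝ)
    (M : ℝ) (hM : IsLUB ((fun x => |u x|) '' closure Ω) M)
    (huc : ContinuousOn u (closure Ω))
    (hu : IsViscositySubsolution Ω Ω α f u)
    (ω : Set (EuclideanSpace ℝ (Fin n))) (hωo : IsOpen ω) (hωne : ω.Nonempty)
    (hωΩ : closure ω ⊆ Ω) :
    (rs ^ β - 1) / (rs - 1) ^ α < 1 ∧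
    ∀ x ∈ ω, ∀ x' ∈ ω,
      |u x - u x'| ≤
        max (2 * M / (sInf ((fun a => Metric.infDist a (frontier Ω)) '' ω)) ^ β)
          (Metric.diam Ω ^ (α - β) * max (-f (-M)) 0 /
            (1 - (rs ^ β - 1) / (rs - 1) ^ α)) * ‖x - x'‖ ^ β := by
  have hΨ := rpow_sub_one_div_lt_one hβ0 hβα hα1 hrs
  refine ⟨hΨ, ?_⟩
  have hbound : ∀ r : ℝ, 1 < r → (r ^ β - 1) / (r - 1) ^ α ≤ (rs ^ β - 1) / (rs - 1) ^ α :=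
    fun r hr => rpow_sub_one_div_le hβ0 hβα hα1 hrs heq hr
  have hd := sInf_infDist_frontier_pos hn hΩo hΩne hΩb hωne hωΩ
  set D := max (2 * M / (sInf ((fun a => Metric.infDist a (frontier Ω)) '' ω)) ^ β)
    (Metric.diam Ω ^ (α - β) * max (-f (-M)) 0 / (1 - (rs ^ β - 1) / (rs - 1) ^ α)) with hD
  have hωsub : ω ⊆ Ω := subset_closure.trans hωΩ
  have key : ∀ z ∈ ω, ∀ x ∈ ω, u x - u z ≤ D * ‖x - z‖ ^ β := by
    intro z hz x hx
    have hlim : Filter.Tendsto (fun C : ℝ => C * ‖x - z‖ ^ β) (nhdsWithin D (Ioi D))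
        (nhds (D * ‖x - z‖ ^ β)) :=
      ((continuous_id.mul continuous_const).tendsto D).mono_left nhdsWithin_le_nhds
    refine ge_of_tendsto hlim ?_
    filter_upwards [self_mem_nhdsWithin] with C hC
    refine hu.sub_le hf hΩo hΩb huc (fun y hy => hM.1 ⟨y, hy, rfl⟩) hβ0 hβα
      (rpow_sub_one_div_nonneg hβ0 hrs) hΨ hbound (hωsub hz) (subset_closure (hωsub hx)) hd
      (csInf_le ⟨0, ?_⟩ ⟨z, hz, rfl⟩) ((le_max_left _ _).trans_lt hC)
      ((le_max_right _ _).trans_lt hC)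
    rintro _ ⟨a, -, rfl⟩
    exact infDist_nonneg
  intro x hx x' hx'
  refine abs_le.2 ⟨?_, key x' hx' x hx⟩
  have h := key x hx x' hx'
  rw [norm_sub_rev] at h
  linarith
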